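/- Let n ≥ 2, p ∈ {1,…,n−1} with gcd(n,p) = 1, q ∈ {1,…,n−1} with pq ≡ 1 (mod n), and let y be a type (i) coupling with M = pπ − ny. For ξ ∈ A_y^+ and j ∈ {1,…,n} set |u_j(ξ)|² = sgn(M)·(ξ_j + ⋯ + ξ_{j+p−1} − y) and W_j(ξ) = [ sin(|u_j(ξ)|²)/|u_j(ξ)|² ] · [ (−1)^{p−1} / sin(ξ_j + ⋯ + ξ_{j+p−1}) ] · ∏_{m=j+1, m≠j+p}^{j+n−1} [ sin(Σ_{k=j}^{m−1} ξ_k − y) / sin(Σ_{k=j}^{m−1} ξ_k) ]. Then z_j(ξ,y) = |u_j(ξ)|² · W_j(ξ) and W_j(ξ) > 0 for every ξ ∈ A_y^+ and every j. -/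

import Mathlib

open Finset Matrix
open scoped BigOperators Real

noncomputable section

/-- Entries of the `(n-1) × (n-1)` integer matrix `A` (1-based indices):
`A_{j,k} = 1` if `1 ≤ j ≤ n-p` and `j ≤ k < j+p`, `A_{j,k} = -1` if
`n-p < j ≤ n-1` and `j+p-n ≤ k < j`, and `0` otherwise. -/
def Aent (n p : ℕ) (j k : ℕ) : ℤ :=
  if j ≤ n - p ∧ j ≤ k ∧ k < j + p then 1
  else if n - p < j ∧ j + p ≤ k + n ∧ k < j then -1
  else 0

open Classical in
/-- Entries of the binary matrix `B`: `B_{m,k} = 0` iff `k - m ≡ ℓ p (mod n)`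
for some `ℓ ∈ {1, …, n-q}`, else `1`. -/
def Bent (n p q : ℕ) (m k : ℕ) : ℤ :=
  if ∃ ℓ ∈ Finset.Icc 1 (n - q), ((k : ℤ) - (m : ℤ)) ≡ ((ℓ * p : ℕ) : ℤ) [ZMOD (n : ℤ)]
  then 0 else 1

open Classical in
/-- Entries of the binary matrix `C`: `C_{m,k} = 0` iff `k ≡ ℓ p (mod n)`
for some `ℓ ∈ {1, …, n-q}`, else `1`. -/
def Cent (n p q : ℕ) (m k : ℕ) : ℤ :=
  if ∃ ℓ ∈ Finset.Icc 1 (n - q), ((k : ℤ)) ≡ ((ℓ * p : ℕ) : ℤ) [ZMOD (n : ℤ)]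
  then 0 else 1

/-- Entries of `Ω = B - C`. -/
def Ωent (n p q : ℕ) (m k : ℕ) : ℤ := Bent n p q m k - Cent n p q m k

/-- The matrix `A` as an `(n-1) × (n-1)` integer matrix. -/
def Amat (n p : ℕ) : Matrix (Fin (n - 1)) (Fin (n - 1)) ℤ :=
  fun j k => Aent n p (j.1 + 1) (k.1 + 1)

/-- The matrix `Ω = B - C` as an `(n-1) × (n-1)` integer matrix. -/
def Ωmat (n p q : ℕ) : Matrix (Fin (n - 1)) (Fin (n - 1)) ℤ :=
  fun j k => Ωent n p q (j.1 + 1) (k.1 + 1)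

/-- Cyclic window sum `ξ_ℓ + ξ_{ℓ+1} + ⋯ + ξ_{ℓ+d-1}`. -/
def wsum (ξ : ℕ → ℝ) (ℓ d : ℕ) : ℝ := ∑ m ∈ Finset.range d, ξ (ℓ + m)

/-- First type (i) interval: `(p/n - 1/(nq))π < y < pπ/n` (so `M = pπ - ny > 0`). -/
def typeI1 (n p q : ℕ) (y : ℝ) : Prop :=
  ((p : ℝ) / n - 1 / ((n : ℝ) * q)) * Real.pi < y ∧ y < (p : ℝ) * Real.pi / n

/-- Second type (i) interval: `pπ/n < y < (p/n + 1/(n(n-q)))π` (so `M = pπ - ny < 0`). -/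
def typeI2 (n p q : ℕ) (y : ℝ) : Prop :=
  (p : ℝ) * Real.pi / n < y ∧ y < ((p : ℝ) / n + 1 / ((n : ℝ) * ((n : ℝ) - q))) * Real.pi

/-- `M = pπ - ny`. -/
def Mval (n p : ℕ) (y : ℝ) : ℝ := (p : ℝ) * Real.pi - (n : ℝ) * y

/-- Membership of `ξ` (a cyclic sequence of reals, indices `1, …, n`) in the open
domain `A_y^+`: cyclic convention `ξ_{m+n} = ξ_m`, positivity, total sum `π`, and
`sgn(M)(ξ_j + ⋯ + ξ_{j+p-1} - y) > 0` for `j = 1, …, n`. -/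
def inAy (n p : ℕ) (y : ℝ) (ξ : ℕ → ℝ) : Prop :=
  (∀ m, ξ (m + n) = ξ m) ∧
  (∀ k, 1 ≤ k → k ≤ n → 0 < ξ k) ∧
  (∑ k ∈ Finset.Icc 1 n, ξ k = Real.pi) ∧
  (∀ j, 1 ≤ j → j ≤ n → 0 < Real.sign (Mval n p y) * (wsum ξ j p - y))

/-- `|u_j(ξ)|² = sgn(M) (ξ_j + ⋯ + ξ_{j+p-1} - y)`. -/
def usq (n p : ℕ) (y : ℝ) (ξ : ℕ → ℝ) (j : ℕ) : ℝ :=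
  Real.sign (Mval n p y) * (wsum ξ j p - y)

/-- `z_ℓ(ξ, w) = sgn(sin(ny)) ∏_{d=1}^{n-1} sin(ξ_ℓ + ⋯ + ξ_{ℓ+d-1} - w)/sin(ξ_ℓ + ⋯ + ξ_{ℓ+d-1})`;
the paper's `z_ℓ(ξ, ±y)` is obtained at `w = ±y`. -/
def zfun (n : ℕ) (y : ℝ) (ξ : ℕ → ℝ) (w : ℝ) (ℓ : ℕ) : ℝ :=
  Real.sign (Real.sin ((n : ℝ) * y)) *
    ∏ d ∈ Finset.Icc 1 (n - 1), Real.sin (wsum ξ ℓ d - w) / Real.sin (wsum ξ ℓ d)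

/-- `x_j - x_ℓ` expressed through `ξ`: `ξ_ℓ + ⋯ + ξ_{j-1}` for `ℓ ≤ j`, antisymmetric. -/
def xdiff (ξ : ℕ → ℝ) (j ℓ : ℕ) : ℝ :=
  if ℓ ≤ j then wsum ξ ℓ (j - ℓ) else -(wsum ξ j (ℓ - j))

/-- `ρ(θ)_ℓ = exp(i(θ_{ℓ-1} - θ_ℓ))` (with the conventions `θ_0 = θ_n = 0` imposed
as hypotheses on `θ`). -/
def ρfun (θ : ℕ → ℝ) (ℓ : ℕ) : ℂ :=
  Complex.exp (Complex.I * ((θ (ℓ - 1) - θ ℓ : ℝ) : ℂ))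

/-- `Δ_j(θ) = exp(i Σ_{k=1}^{n-1} Ω_{j,k} θ_k)` for `1 ≤ j ≤ n-1`, and `Δ_n(θ) = 1`. -/
def Δfun (n p q : ℕ) (θ : ℕ → ℝ) (j : ℕ) : ℂ :=
  if j = n then 1
  else Complex.exp (Complex.I *
    ((∑ k ∈ Finset.Icc 1 (n - 1), (Ωent n p q j k : ℝ) * θ k : ℝ) : ℂ))

/-- The local trigonometric Lax matrix
`L(ξ,θ)_{j,ℓ} = [sin y / sin(x_j - x_ℓ + y)] v_j(ξ,y) v_ℓ(ξ,-y) ρ(θ)_ℓ`. -/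
def Lloc (n : ℕ) (y : ℝ) (ξ θ : ℕ → ℝ) (j ℓ : ℕ) : ℂ :=
  ((Real.sin y / Real.sin (xdiff ξ j ℓ + y) : ℝ) : ℂ) *
    ((Real.sqrt (zfun n y ξ y j) : ℝ) : ℂ) *
    ((Real.sqrt (zfun n y ξ (-y) ℓ) : ℝ) : ℂ) * ρfun θ ℓ

/-- The embedding map `ℰ(ξ,θ)_j = |u_j(ξ)| Δ_j(θ)^{sgn M}` for `j = 1, …, n-1`
and `ℰ(ξ,θ)_n = |u_n(ξ)|` (note `Δ_n = 1`). -/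
def Emap (n p q : ℕ) (y : ℝ) (ξ θ : ℕ → ℝ) (j : ℕ) : ℂ :=
  ((Real.sqrt (usq n p y ξ j) : ℝ) : ℂ) *
    Δfun n p q θ j ^ (if 0 < Mval n p y then (1 : ℤ) else -1)

/-- `σ(ℓ) = ℓ + n - p` if `1 ≤ ℓ ≤ p`, and `σ(ℓ) = ℓ - p` if `p < ℓ ≤ n`. -/
def σmap (n p : ℕ) (ℓ : ℕ) : ℕ := if ℓ ≤ p then ℓ + n - p else ℓ - p

/-- The Weierstrass-type function
`ws_b(z) = sin z ∏_{m=1}^∞ (1 + sin² z / sinh²(2 m b))` with `ω = π/2`, `ω' = i b`. -/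
def wsb (b : ℝ) (z : ℂ) : ℂ :=
  Complex.sin z *
    ∏' m : ℕ, (1 + Complex.sin z ^ 2 / Complex.sinh (2 * ((m : ℂ) + 1) * (b : ℂ)) ^ 2)

/-- Elliptic analogue of `zfun`, built from `ws_b` instead of `sin`. -/
def zbfun (b : ℝ) (n : ℕ) (y : ℝ) (ξ : ℕ → ℝ) (w : ℝ) (ℓ : ℕ) : ℝ :=
  Real.sign ((wsb b (((n : ℝ) * y : ℝ) : ℂ)).re) *
    ∏ d ∈ Finset.Icc 1 (n - 1),
      (wsb b ((wsum ξ ℓ d - w : ℝ) : ℂ)).re / (wsb b ((wsum ξ ℓ d : ℝ) : ℂ)).re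

/-- The local elliptic Lax matrix with spectral parameter `lam`. -/
def Lbloc (b : ℝ) (n : ℕ) (y : ℝ) (lam : ℂ) (ξ θ : ℕ → ℝ) (j ℓ : ℕ) : ℂ :=
  (wsb b ((y : ℝ) : ℂ) / wsb b lam) *
    (wsb b (((xdiff ξ j ℓ : ℝ) : ℂ) + lam) / wsb b ((xdiff ξ j ℓ + y : ℝ) : ℂ)) *
    ((Real.sqrt (zbfun b n y ξ y j) : ℝ) : ℂ) *
    ((Real.sqrt (zbfun b n y ξ (-y) ℓ) : ℝ) : ℂ) * ρfun θ ℓ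

/-- The subset `S = {ℓ p mod n : ℓ = 1, …, n-q}` of `ℤ/nℤ`. -/
def Sset (n p q : ℕ) : Finset (ZMod n) :=
  (Finset.Icc 1 (n - q)).image (fun ℓ => ((ℓ * p : ℕ) : ZMod n))

/-- The subset `S_i = {i + ℓ mod n : ℓ = 0, …, p-1}` of `ℤ/nℤ`. -/
def Siset (n p : ℕ) (i : ZMod n) : Finset (ZMod n) :=
  (Finset.range p).image (fun ℓ : ℕ => i + (ℓ : ZMod n))

/-- `I_i = |S_i ∩ S|`. -/
def Inum (n p q : ℕ) (i : ZMod n) : ℕ := (Siset n p i ∩ Sset n p q).card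

/-- The function `W_j(ξ)` of Statement 13. -/
def Wfun (n p : ℕ) (y : ℝ) (ξ : ℕ → ℝ) (j : ℕ) : ℝ :=
  (Real.sin (usq n p y ξ j) / usq n p y ξ j) *
    ((-1 : ℝ) ^ (p - 1) / Real.sin (wsum ξ j p)) *
    ∏ d ∈ (Finset.Icc 1 (n - 1)).erase p,
      Real.sin (wsum ξ j d - y) / Real.sin (wsum ξ j d)

section CouplingBounds

variable {n p q k : ℕ} {y : ℝ}

theorem typeI1_iff (hn : 0 < n) (hq : 0 < q) (hk : p * q = n * k + 1) :
    typeI1 n p q y ↔ k * π < q * y ∧ 0 < Mval n p y := by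
  have hn' : (0 : ℝ) < n := by exact_mod_cast hn
  have hq' : (0 : ℝ) < q := by exact_mod_cast hq
  have hk' : (p : ℝ) * q = n * k + 1 := by exact_mod_cast hk
  have h : ((p : ℝ) / n - 1 / (n * q)) * π = k * π / q := by
    field_simp
    linear_combination hk'
  rw [typeI1, Mval, h, div_lt_iff₀ hq', lt_div_iff₀ hn', mul_comm y, mul_comm y, sub_pos]

theorem typeI2_iff (hn : 0 < n) (hq : q < n) (hk : p * q = n * k + 1) :
    typeI2 n p q y ↔ Mval n p y < 0 ∧ ((n : ℝ) - q) * y < (p - k) * π := by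
  have hn' : (0 : ℝ) < n := by exact_mod_cast hn
  have hq' : (0 : ℝ) < (n : ℝ) - q := sub_pos.2 (by exact_mod_cast hq)
  have hk' : (p : ℝ) * q = n * k + 1 := by exact_mod_cast hk
  have h : ((p : ℝ) / n + 1 / (n * (n - q))) * π = (p - k) * π / (n - q) := by
    field_simp
    linear_combination -hk'
  rw [typeI2, Mval, h, lt_div_iff₀ hq', div_lt_iff₀ hn', mul_comm y, mul_comm y, sub_neg]

theorem abs_Mval_lt_pi (hn : 0 < n) (hq : 0 < q) (hqn : q < n) (hk : p * q = n * k + 1)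
    (hy : typeI1 n p q y ∨ typeI2 n p q y) : |Mval n p y| < π := by
  have hk' : (p : ℝ) * q = n * k + 1 := by exact_mod_cast hk
  have hn' : (0 : ℝ) < n := by exact_mod_cast hn
  have hπ := Real.pi_pos
  rw [typeI1_iff hn hq hk, typeI2_iff hn hqn hk] at hy
  rcases hy with ⟨h, hM⟩ | ⟨hM, h⟩
  · rw [abs_of_pos hM]
    have hq' : (1 : ℝ) ≤ q := by exact_mod_cast hq
    calc Mval n p y ≤ q * Mval n p y := le_mul_of_one_le_left hM.le hq'
      _ = (n * k + 1) * π - n * (q * y) := by rw [← hk', Mval]; ring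
      _ < (n * k + 1) * π - n * (k * π) := by gcongr
      _ = π := by ring
  · rw [abs_of_neg hM]
    have hq' : (1 : ℝ) ≤ (n : ℝ) - q := by
      rw [le_sub_iff_add_le']
      exact_mod_cast hqn
    calc -Mval n p y ≤ (n - q) * -Mval n p y := le_mul_of_one_le_left (neg_nonneg.2 hM.le) hq'
      _ = n * ((n - q) * y) - (n * p - (n * k + 1)) * π := by rw [← hk', Mval]; ring
      _ < n * ((p - k) * π) - (n * p - (n * k + 1)) * π := by gcongr
      _ = π := by ring

theorem coupling_mem_Ioo (hp : 0 < p) (hpn : p < n) (hq : 0 < q) (hqn : q < n)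
    (hk : p * q = n * k + 1) (hy : typeI1 n p q y ∨ typeI2 n p q y) :
    y ∈ Set.Ioo 0 π := by
  have hn : 0 < n := hp.trans hpn
  have hn' : (0 : ℝ) < n := by exact_mod_cast hn
  have hp' : (0 : ℝ) < p := by exact_mod_cast hp
  have hpn' : (p : ℝ) + 1 ≤ n := by exact_mod_cast hpn
  have hq' : (0 : ℝ) < q := by exact_mod_cast hq
  have hπ := Real.pi_pos
  have hM := (abs_lt.1 (abs_Mval_lt_pi hn hq hqn hk hy)).1
  constructor
  · rcases hy with hy | hy
    · have h := ((typeI1_iff hn hq hk).1 hy).1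
      exact pos_of_mul_pos_right ((by positivity : (0 : ℝ) ≤ k * π).trans_lt h) hq'.le
    · exact (by positivity : (0 : ℝ) < p * π / n).trans hy.1
  · refine lt_of_mul_lt_mul_left ?_ hn'.le
    rw [Mval] at hM
    nlinarith

theorem sign_sin_mul (hp : 0 < p) (hM : |Mval n p y| < π) :
    Real.sign (Real.sin (n * y)) = Real.sign (Mval n p y) * (-1) ^ (p - 1) := by
  obtain ⟨r, rfl⟩ := Nat.exists_eq_add_one.2 hp
  have hsin : Real.sin (n * y) = (-1) ^ r * Real.sin (Mval n (r + 1) y) := by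
    have h : (n : ℝ) * y = (π - Mval n (r + 1) y) + r * π := by
      rw [Mval]; push_cast; ring
    rw [h, Real.sin_add_nat_mul_pi, Real.sin_pi_sub]
  have hsign : Real.sign (Real.sin (Mval n (r + 1) y)) =
      Real.sign (Mval n (r + 1) y) := by
    obtain ⟨h₁, h₂⟩ := abs_lt.1 hM
    rcases lt_trichotomy (Mval n (r + 1) y) 0 with h | h | h
    · rw [Real.sign_of_neg h, Real.sign_of_neg (Real.sin_neg_of_neg_of_neg_pi_lt h h₁)]
    · simp [h]
    · rw [Real.sign_of_pos h, Real.sign_of_pos (Real.sin_pos_of_pos_of_lt_pi h h₂)]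
  rw [hsin]
  rcases neg_one_pow_eq_or ℝ r with h | h <;> simp [h, Real.sign_neg, hsign]

end CouplingBounds

section Windows

variable {n p : ℕ} {ξ : ℕ → ℝ}

theorem wsum_add (ξ : ℕ → ℝ) (a d e : ℕ) :
    wsum ξ a (d + e) = wsum ξ a d + wsum ξ (a + d) e := by
  simp only [wsum, Finset.sum_range_add, add_assoc]

theorem wsum_pos (h : ∀ a, 0 < ξ a) (a : ℕ) {d : ℕ} (hd : 0 < d) : 0 < wsum ξ a d :=
  Finset.sum_pos (fun _ _ => h _) (by simpa using hd.ne')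

theorem wsum_strictMono (h : ∀ a, 0 < ξ a) (a : ℕ) : StrictMono (wsum ξ a) :=
  strictMono_nat_of_lt_succ fun d => by
    rw [wsum, wsum, Finset.sum_range_succ]
    exact lt_add_of_pos_right _ (h _)

theorem exists_wsum_eq (hn : 0 < n) (hper : Function.Periodic ξ n) (a : ℕ) :
    ∃ b, 1 ≤ b ∧ b ≤ n ∧ ∀ m, ξ (a + m) = ξ (b + m) := by
  have hlt := Nat.mod_lt (a + n - 1) hn
  refine ⟨(a + n - 1) % n + 1, by omega, by omega, fun m => ?_⟩
  have h : ((a + n - 1) % n + 1 + m) % n = (a + m) % n := by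
    rw [add_assoc, Nat.mod_add_mod, show a + n - 1 + (1 + m) = a + m + n by omega,
      Nat.add_mod_right]
  rw [← hper.map_mod_nat (a + m), ← hper.map_mod_nat ((a + n - 1) % n + 1 + m), h]

theorem wsum_period (hper : Function.Periodic ξ n) (a : ℕ) :
    wsum ξ a n = ∑ k ∈ Finset.Icc 1 n, ξ k := by
  have h₁ : ∀ a, wsum ξ a n = wsum ξ 0 n := by
    intro a
    induction a with
    | zero => rfl
    | succ a ih =>
      have h₂ := wsum_add ξ a 1 n
      rw [add_comm 1 n, wsum_add] at h₂
      have h₃ : wsum ξ (a + n) 1 = wsum ξ a 1 := by simp [wsum, hper a]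
      linarith
  rw [h₁ a, ← h₁ 1, wsum, Finset.range_eq_Ico, Finset.sum_Ico_add ξ 0 n 1, zero_add,
    add_comm n 1]
  congr 1
  ext m
  simp only [Finset.mem_Ico, Finset.mem_Icc]
  omega

theorem wsum_mul_period (hper : Function.Periodic ξ n) (a m : ℕ) :
    wsum ξ a (m * n) = m * ∑ k ∈ Finset.Icc 1 n, ξ k := by
  induction m with
  | zero => simp [wsum]
  | succ m ih => rw [add_one_mul, wsum_add, ih, wsum_period hper]; push_cast; ring

theorem nonneg_mul_wsum_mul_sub {ε y : ℝ} (h : ∀ a, 0 < ε * (wsum ξ a p - y)) (a m : ℕ) :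
    0 ≤ ε * (wsum ξ a (m * p) - m * y) := by
  induction m with
  | zero => simp [wsum]
  | succ m ih =>
    rw [add_one_mul, wsum_add]
    push_cast
    linarith [h (a + m * p)]

end Windows

namespace inAy

variable {n p q k : ℕ} {y : ℝ} {ξ : ℕ → ℝ}

theorem periodic (hξ : inAy n p y ξ) : Function.Periodic ξ n := hξ.1

theorem pos (hn : 0 < n) (hξ : inAy n p y ξ) (a : ℕ) : 0 < ξ a := by
  obtain ⟨b, hb₁, hb₂, h⟩ := exists_wsum_eq hn hξ.periodic a
  have := h 0
  rw [add_zero, add_zero] at this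
  exact this ▸ hξ.2.1 b hb₁ hb₂

theorem usq_pos (hn : 0 < n) (hξ : inAy n p y ξ) (a : ℕ) : 0 < usq n p y ξ a := by
  obtain ⟨b, hb₁, hb₂, h⟩ := exists_wsum_eq hn hξ.periodic a
  have hw : wsum ξ a p = wsum ξ b p := by simp only [wsum, h]
  rw [usq, hw]
  exact hξ.2.2.2 b hb₁ hb₂

theorem wsum_mul (hξ : inAy n p y ξ) (a m : ℕ) : wsum ξ a (m * n) = m * π := by
  rw [wsum_mul_period hξ.periodic, hξ.2.2.1]

theorem wsum_mem_Ioo (hξ : inAy n p y ξ) (a : ℕ) {d : ℕ} (hd : 0 < d) (hdn : d < n) :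
    wsum ξ a d ∈ Set.Ioo 0 π := by
  have hpos := hξ.pos (hd.trans hdn)
  refine ⟨wsum_pos hpos a hd, ?_⟩
  have h := hξ.wsum_mul a 1
  rw [one_mul, Nat.cast_one, one_mul] at h
  exact h ▸ wsum_strictMono hpos a hdn

theorem wsum_lt_of_lt (hp : 0 < p) (hpn : p < n) (hq : 0 < q) (hqn : q < n)
    (hk : p * q = n * k + 1) (hy : typeI1 n p q y ∨ typeI2 n p q y) (hξ : inAy n p y ξ)
    (a : ℕ) {d : ℕ} (hd : d < p) : wsum ξ a d < y := by
  have hn : 0 < n := hp.trans hpn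
  have hmono := wsum_strictMono (hξ.pos hn) a
  rcases hy with hy | hy
  · obtain ⟨h, hM⟩ := (typeI1_iff hn hq hk).1 hy
    have hu : ∀ a, 0 < 1 * (wsum ξ a p - y) := fun a => by
      simpa [usq, Real.sign_of_pos hM] using hξ.usq_pos hn a
    have hchain := nonneg_mul_wsum_mul_sub hu (a + (p - 1)) (q - 1)
    have hlen : k * n = (p - 1) + (q - 1) * p := by
      zify [Nat.one_le_iff_ne_zero.2 hp.ne', Nat.one_le_iff_ne_zero.2 hq.ne'] at hk ⊢
      linear_combination -hk
    have htot := hξ.wsum_mul a k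
    rw [hlen, wsum_add] at htot
    have hle : wsum ξ a d ≤ wsum ξ a (p - 1) := hmono.monotone (by omega)
    rw [Nat.cast_sub hq, Nat.cast_one] at hchain
    linarith
  · have hM := ((typeI2_iff hn hqn hk).1 hy).1
    have hu := hξ.usq_pos hn a
    rw [usq, Real.sign_of_neg hM] at hu
    linarith [hmono hd]

theorem lt_wsum_of_lt (hp : 0 < p) (hpn : p < n) (hq : 0 < q) (hqn : q < n)
    (hk : p * q = n * k + 1) (hy : typeI1 n p q y ∨ typeI2 n p q y) (hξ : inAy n p y ξ)
    (a : ℕ) {d : ℕ} (hpd : p < d) (hdn : d < n) : y < wsum ξ a d := by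
  have hn : 0 < n := hp.trans hpn
  have hmono := wsum_strictMono (hξ.pos hn) a
  rcases hy with hy | hy
  · have hM := ((typeI1_iff hn hq hk).1 hy).2
    have hu := hξ.usq_pos hn a
    rw [usq, Real.sign_of_pos hM] at hu
    linarith [hmono hpd]
  · obtain ⟨hM, h⟩ := (typeI2_iff hn hqn hk).1 hy
    have hu : ∀ a, 0 < -1 * (wsum ξ a p - y) := fun a => by
      have := hξ.usq_pos hn a
      rwa [usq, Real.sign_of_neg hM] at this
    have hchain := nonneg_mul_wsum_mul_sub hu (a + (p + 1)) (n - q - 1)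
    have hkp : k ≤ p := by nlinarith
    have hlen : (p - k) * n = (p + 1) + (n - q - 1) * p := by
      rw [Nat.sub_sub]
      zify [hkp, Nat.succ_le_of_lt hqn] at hk ⊢
      linear_combination hk
    have htot := hξ.wsum_mul a (p - k)
    rw [hlen, wsum_add] at htot
    have hle : wsum ξ a (p + 1) ≤ wsum ξ a d := hmono.monotone hpd
    rw [Nat.sub_sub, Nat.cast_sub hqn] at hchain
    rw [Nat.cast_sub hkp, Nat.sub_sub] at htot
    push_cast at hchain
    linarith

end inAy

theorem prod_erase_ite_neg_one {n p : ℕ} (hpn : p ≤ n) :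
    ∏ d ∈ (Finset.Icc 1 n).erase p, (if d < p then (-1 : ℝ) else 1) = (-1) ^ (p - 1) := by
  have h : {d ∈ (Finset.Icc 1 n).erase p | d < p} = Finset.Ico 1 p := by
    ext d
    simp only [Finset.mem_filter, Finset.mem_erase, Finset.mem_Icc, Finset.mem_Ico]
    omega
  rw [Finset.prod_ite, Finset.prod_const, Finset.prod_const_one, mul_one, h, Nat.card_Ico]

/-- `z_j(ξ,y) = |u_j(ξ)|² W_j(ξ)` with `W_j(ξ) > 0` on `A_y^+`. -/
theorem stmt13 (n p q : ℕ) (hn : 2 ≤ n) (hp1 : 1 ≤ p) (hpn : p ≤ n - 1)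
    (hgcd : Nat.gcd n p = 1) (hq1 : 1 ≤ q) (hqn : q ≤ n - 1)
    (hpq : p * q ≡ 1 [MOD n])
    (y : ℝ) (hy : typeI1 n p q y ∨ typeI2 n p q y)
    (ξ : ℕ → ℝ) (hξ : inAy n p y ξ)
    (j : ℕ) (hj1 : 1 ≤ j) (hjn : j ≤ n) :
    zfun n y ξ y j = usq n p y ξ j * Wfun n p y ξ j ∧
    0 < Wfun n p y ξ j := by
  have hn₀ : 0 < n := by omega
  have hp : p < n := by omega
  have hq : q < n := by omega
  obtain ⟨k, hk⟩ : ∃ k, p * q = n * k + 1 := by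
    refine ⟨p * q / n, ?_⟩
    have h : p * q % n = 1 := Eq.trans hpq (Nat.mod_eq_of_lt hn)
    rw [← h, Nat.div_add_mod]
  have hM := abs_Mval_lt_pi hn₀ hq1 hq hk hy
  obtain ⟨hy₀, hyπ⟩ := coupling_mem_Ioo hp1 hp hq1 hq hk hy
  have hu := hξ.usq_pos hn₀ j
  obtain ⟨hX₀, hXπ⟩ := hξ.wsum_mem_Ioo j hp1 hp
  have hM₀ : Mval n p y ≠ 0 := by
    intro h
    simp [usq, h] at hu
  obtain ⟨hsin, huπ⟩ : Real.sin (usq n p y ξ j) =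
      Real.sign (Mval n p y) * Real.sin (wsum ξ j p - y) ∧ usq n p y ξ j < π := by
    rcases Real.sign_apply_eq_of_ne_zero _ hM₀ with h | h
    · rw [usq, h, neg_one_mul, Real.sin_neg, neg_one_mul]
      exact ⟨rfl, by linarith⟩
    · rw [usq, h, one_mul, one_mul]
      exact ⟨rfl, by linarith⟩
  constructor
  · rw [zfun, Wfun, sign_sin_mul hp1 hM,
      ← Finset.mul_prod_erase _ _ (Finset.mem_Icc.2 ⟨hp1, hpn⟩), hsin]
    field_simp
  · have hprod : 0 < (-1 : ℝ) ^ (p - 1) * ∏ d ∈ (Finset.Icc 1 (n - 1)).erase p,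
        Real.sin (wsum ξ j d - y) / Real.sin (wsum ξ j d) := by
      rw [← prod_erase_ite_neg_one hpn, ← Finset.prod_mul_distrib]
      refine Finset.prod_pos fun d hd => ?_
      obtain ⟨hdp, hd⟩ := Finset.mem_erase.1 hd
      obtain ⟨hd₁, hdn⟩ := Finset.mem_Icc.1 hd
      have hd₂ : d < n := by omega
      obtain ⟨hd₀, hdπ⟩ := hξ.wsum_mem_Ioo j hd₁ hd₂
      have hden := Real.sin_pos_of_pos_of_lt_pi hd₀ hdπ
      split_ifs with h
      · have hlt := hξ.wsum_lt_of_lt hp1 hp hq1 hq hk hy j h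
        rw [neg_one_mul, neg_pos]
        exact div_neg_of_neg_of_pos
          (Real.sin_neg_of_neg_of_neg_pi_lt (by linarith) (by linarith)) hden
      · have hlt := hξ.lt_wsum_of_lt hp1 hp hq1 hq hk hy j (by omega : p < d) hd₂
        rw [one_mul]
        exact div_pos (Real.sin_pos_of_pos_of_lt_pi (by linarith) (by linarith)) hden
    have hW : Wfun n p y ξ j = Real.sin (usq n p y ξ j) / usq n p y ξ j /
        Real.sin (wsum ξ j p) * ((-1 : ℝ) ^ (p - 1) *
          ∏ d ∈ (Finset.Icc 1 (n - 1)).erase p,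
            Real.sin (wsum ξ j d - y) / Real.sin (wsum ξ j d)) := by
      rw [Wfun]
      ring
    rw [hW]
    exact mul_pos (div_pos (div_pos (Real.sin_pos_of_pos_of_lt_pi hu huπ) hu)
      (Real.sin_pos_of_pos_of_lt_pi hX₀ hXπ)) hprod

end
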